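/- The series ∑_{n=0}^∞ ((1/2)_n (1/4)_n (3/4)_n)/((1)_n^3) · (7n+1) · (32/81)^n equals 9/(2π). -/

import Mathlib

open Real

noncomputable def poch (a : ℝ) (n : ℕ) : ℝ := (ascPochhammer ℝ n).eval a

open Filter Topology

noncomputable def SS (c : ℕ → ℝ) (i : ℕ) (x : ℝ) : ℝ := ∑' n : ℕ, ((n:ℝ)^i * c n) * x^n

lemma SS_summable_abs {c : ℕ → ℝ} (hc : ∀ n, |c n| ≤ 1) (i : ℕ) {r : ℝ} (h0 : 0 ≤ r) (h1 : r < 1) :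
    Summable (fun n : ℕ => |(n:ℝ)^i * c n| * r^n) := by
  refine Summable.of_nonneg_of_le (fun n => by positivity) (fun n => ?_)
    (summable_pow_mul_geometric_of_norm_lt_one i (r := r) (by rwa [Real.norm_eq_abs, abs_of_nonneg h0]))
  gcongr
  rw [abs_mul, abs_of_nonneg (by positivity : (0:ℝ) ≤ (n:ℝ)^i)]
  exact mul_le_of_le_one_right (by positivity) (hc n)

lemma SS_summable {c : ℕ → ℝ} (hc : ∀ n, |c n| ≤ 1) (i : ℕ) {x : ℝ} (hx : |x| < 1) :
    Summable (fun n : ℕ => ((n:ℝ)^i * c n) * x^n) := by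
  refine Summable.of_norm ?_
  simpa [abs_mul, abs_pow] using SS_summable_abs hc i (abs_nonneg x) hx

lemma SS_analytic {c : ℕ → ℝ} (hc : ∀ n, |c n| ≤ 1) (i : ℕ) {x : ℝ} (hx : |x| < 1) :
    AnalyticAt ℝ (SS c i) x := by
  obtain ⟨r, hr1, hr2⟩ := exists_between hx
  have hr0 : 0 < r := (abs_nonneg x).trans_lt hr1
  set P := FormalMultilinearSeries.ofScalars ℝ (fun n : ℕ => (n:ℝ)^i * c n) with hP
  have hrad : ((r.toNNReal) : ENNReal) ≤ P.radius := by
    apply P.le_radius_of_summable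
    have := SS_summable_abs hc i hr0.le hr2
    simpa [hP, FormalMultilinearSeries.ofScalars_norm, hr0.le] using this
  have hpos : 0 < P.radius := lt_of_lt_of_le (by simpa using hr0) hrad
  have hs : P.sum = SS c i := by
    funext y
    have := FormalMultilinearSeries.ofScalars_sum_eq (E := ℝ) (fun n : ℕ => (n:ℝ)^i * c n) y
    simpa [SS, FormalMultilinearSeries.ofScalarsSum] using this
  have hb := P.hasFPowerSeriesOnBall hpos
  rw [hs] at hb
  apply hb.analyticAt_of_mem
  refine Metric.eball_subset_eball hrad ?_
  rw [Metric.eball_coe]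
  simpa [hr0.le] using hr1

lemma SS_deriv {c : ℕ → ℝ} (hc : ∀ n, |c n| ≤ 1) (i : ℕ) {x : ℝ} (hx : |x| < 1) :
    x * deriv (SS c i) x = SS c (i+1) x := by
  obtain ⟨r, hr1, hr2⟩ := exists_between hx
  have hr0 : 0 < r := (abs_nonneg x).trans_lt hr1
  have hd : HasDerivAt (SS c i) (∑' n : ℕ, ((n:ℝ)^i * c n) * ((n:ℝ) * x^(n-1))) x := by
    refine hasDerivAt_tsum_of_isPreconnected (u := fun n : ℕ => (|(n:ℝ)^(i+1) * c n| * r^n) * r⁻¹)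
      (t := Set.Ioo (-r) r) (y₀ := x)
      ((SS_summable_abs hc (i+1) hr0.le hr2).mul_right _) isOpen_Ioo isPreconnected_Ioo
      (fun n y hy => (hasDerivAt_pow n y).const_mul _) (fun n y hy => ?_) (abs_lt.mp hr1)
      (SS_summable hc i hx) (abs_lt.mp hr1)
    rcases n with _ | n
    · simp
    · have : |y| ≤ r := (abs_lt.mpr hy).le
      simp only [norm_mul, norm_pow, Real.norm_eq_abs, abs_mul, abs_pow, Nat.add_sub_cancel]
      rw [pow_succ r n]
      have h3 : |y|^n ≤ r^n := by gcongr
      have e : |((n+1:ℕ):ℝ)| ^ (i+1) * |c (n+1)| * (r^n * r) * r⁻¹ =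
        |((n+1:ℕ):ℝ)| ^ i * |c (n+1)| * (|((n+1:ℕ):ℝ)| * r^n) := by
        field_simp
        ring
      rw [e]
      gcongr
  rw [hd.deriv, ← tsum_mul_left]
  unfold SS
  congr 1; funext n
  rcases n with _ | n
  · simp
  · simp only [Nat.add_sub_cancel]; ring

noncomputable def cu (n : ℕ) : ℝ := (poch (1/2) n)^2 / (poch 1 n)^2
noncomputable def ca (n : ℕ) : ℝ := (poch (1/2) n * poch (1/4) n * poch (3/4) n) / (poch 1 n)^3

lemma poch_zero (a : ℝ) : poch a 0 = 1 := by simp [poch]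
lemma poch_succ (a : ℝ) (n : ℕ) : poch a (n+1) = poch a n * (a + n) := by
  simp [poch, ascPochhammer_succ_eval]
lemma poch_pos {a : ℝ} (ha : 0 < a) (n : ℕ) : 0 < poch a n := by
  induction n with
  | zero => simp [poch_zero]
  | succ n ih => rw [poch_succ]; positivity
lemma poch_le {a : ℝ} (ha : 0 < a) (h1 : a ≤ 1) (n : ℕ) : poch a n ≤ poch 1 n := by
  induction n with
  | zero => simp [poch_zero]
  | succ n ih =>
    rw [poch_succ, poch_succ]
    have := poch_pos ha n
    have := poch_pos one_pos n
    gcongr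

lemma cu_pos (n : ℕ) : 0 < cu n := by
  have h1 := poch_pos (show (0:ℝ) < 1/2 by norm_num) n
  have h2 := poch_pos one_pos n
  unfold cu; positivity
lemma ca_pos (n : ℕ) : 0 < ca n := by
  have h1 := poch_pos (show (0:ℝ) < 1/2 by norm_num) n
  have h3 := poch_pos (show (0:ℝ) < 1/4 by norm_num) n
  have h4 := poch_pos (show (0:ℝ) < 3/4 by norm_num) n
  have h2 := poch_pos one_pos n
  unfold ca; positivity
lemma cu_le (n : ℕ) : |cu n| ≤ 1 := by
  rw [abs_of_pos (cu_pos n)]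
  have h1 := poch_pos (show (0:ℝ) < 1/2 by norm_num) n
  have h2 := poch_pos one_pos n
  unfold cu
  rw [div_le_one (by positivity)]
  have := poch_le (show (0:ℝ) < 1/2 by norm_num) (by norm_num) n
  gcongr
lemma ca_le (n : ℕ) : |ca n| ≤ 1 := by
  rw [abs_of_pos (ca_pos n)]
  have h1 := poch_pos (show (0:ℝ) < 1/2 by norm_num) n
  have h3 := poch_pos (show (0:ℝ) < 1/4 by norm_num) n
  have h4 := poch_pos (show (0:ℝ) < 3/4 by norm_num) n
  have h2 := poch_pos one_pos n
  unfold ca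
  rw [div_le_one (by positivity)]
  have g1 := poch_le (show (0:ℝ) < 1/2 by norm_num) (by norm_num) n
  have g2 := poch_le (show (0:ℝ) < 1/4 by norm_num) (by norm_num) n
  have g3 := poch_le (show (0:ℝ) < 3/4 by norm_num) (by norm_num) n
  calc _ ≤ poch 1 n * poch 1 n * poch 1 n := by gcongr
    _ = _ := by ring

lemma cu_succ (n : ℕ) : ((n:ℝ)+1)^2 * cu (n+1) = ((n:ℝ)+1/2)^2 * cu n := by
  have h2 := poch_pos one_pos n
  unfold cu
  rw [poch_succ, poch_succ]
  field_simp
  ring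
lemma ca_succ (n : ℕ) : ((n:ℝ)+1)^3 * ca (n+1) = ((n:ℝ)+1/2)*((n:ℝ)+1/4)*((n:ℝ)+3/4) * ca n := by
  have h2 := poch_pos one_pos n
  unfold ca
  rw [poch_succ, poch_succ, poch_succ, poch_succ]
  field_simp
  ring

lemma SS_shift {c : ℕ → ℝ} (hc : ∀ n, |c n| ≤ 1) (i : ℕ) {x : ℝ} (hx : |x| < 1) :
    SS c (i+1) x = ∑' n : ℕ, ((((n:ℝ)+1)^(i+1) * c (n+1)) * x^(n+1)) := by
  unfold SS
  rw [(SS_summable hc (i+1) hx).tsum_eq_zero_add]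
  simp

lemma ode_u {x : ℝ} (hx : |x| < 1) :
    (1-x) * SS cu 2 x = x * (SS cu 1 x + SS cu 0 x / 4) := by
  have h := SS_shift cu_le 1 hx
  have e : ∀ n : ℕ, ((((n:ℝ)+1)^(1+1) * cu (n+1)) * x^(n+1)) =
     x * (((n:ℝ)^2 * cu n) * x^n + (((n:ℝ)^1 * cu n) * x^n) + 1/4 * (((n:ℝ)^0 * cu n) * x^n)) := by
    intro n
    rw [show 1+1 = 2 from rfl, cu_succ]; ring
  simp_rw [e] at h
  rw [tsum_mul_left, Summable.tsum_add, Summable.tsum_add, tsum_mul_left] at h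
  · change SS cu 2 x = x * (SS cu 2 x + SS cu 1 x + 1/4 * SS cu 0 x) at h
    linarith
  · exact SS_summable cu_le 2 hx
  · exact SS_summable cu_le 1 hx
  · exact (SS_summable cu_le 2 hx).add (SS_summable cu_le 1 hx)
  · exact (SS_summable cu_le 0 hx).mul_left _

lemma ode_a {x : ℝ} (hx : |x| < 1) :
    (1-x) * SS ca 3 x = x * (3/2 * SS ca 2 x + 11/16 * SS ca 1 x + 3/32 * SS ca 0 x) := by
  have h := SS_shift ca_le 2 hx
  have e : ∀ n : ℕ, ((((n:ℝ)+1)^(2+1) * ca (n+1)) * x^(n+1)) =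
     x * (((n:ℝ)^3 * ca n) * x^n + 3/2 * (((n:ℝ)^2 * ca n) * x^n) + 11/16 * (((n:ℝ)^1 * ca n) * x^n)
       + 3/32 * (((n:ℝ)^0 * ca n) * x^n)) := by
    intro n
    rw [show 2+1 = 3 from rfl, ca_succ]; ring
  simp_rw [e] at h
  have s3 := SS_summable ca_le 3 hx
  have s2 := (SS_summable ca_le 2 hx).mul_left (3/2)
  have s1 := (SS_summable ca_le 1 hx).mul_left (11/16)
  have s0 := (SS_summable ca_le 0 hx).mul_left (3/32)
  rw [tsum_mul_left, Summable.tsum_add ((s3.add s2).add s1) s0, Summable.tsum_add (s3.add s2) s1,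
    Summable.tsum_add s3 s2, tsum_mul_left, tsum_mul_left, tsum_mul_left] at h
  change SS ca 3 x = x * (SS ca 3 x + 3/2 * SS ca 2 x + 11/16 * SS ca 1 x + 3/32 * SS ca 0 x) at h
  linarith

lemma SS_zero_zero (c : ℕ → ℝ) : SS c 0 0 = c 0 := by
  unfold SS
  rw [tsum_eq_single 0]
  · simp
  · intro n hn; simp [hn]

/-- Coefficients converging to `L` give `(1-x) Σ c_n x^n → L`. -/
lemma abel_coeff {c : ℕ → ℝ} (hc : ∀ n, |c n| ≤ 1) (i : ℕ) {L : ℝ}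
    (hL : Tendsto (fun n : ℕ => (n:ℝ)^i * c n) atTop (𝓝 L)) :
    Tendsto (fun x => (1-x) * SS c i x) (𝓝[<] 1) (𝓝 L) := by
  set d : ℕ → ℝ := fun n => (n:ℝ)^i * c n with hd
  let f : ℕ → ℝ := fun n => Nat.casesOn n (d 0) (fun m => d (m+1) - d m)
  have hf : ∀ n, ∑ k ∈ Finset.range (n+1), f k = d n := by
    intro n
    induction n with
    | zero => simp [f]
    | succ n ih => rw [Finset.sum_range_succ, ih]; simp [f]
  have ht : Tendsto (fun n ↦ ∑ k ∈ Finset.range n, f k) atTop (𝓝 L) := by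
    rw [← tendsto_add_atTop_iff_nat 1]
    simpa only [hf] using hL
  have := Real.tendsto_tsum_powerSeries_nhdsWithin_lt ht
  refine this.congr' ?_
  filter_upwards [Ioo_mem_nhdsLT (show (0:ℝ) < 1 by norm_num)] with x hx
  have hx1 : |x| < 1 := by rw [abs_of_pos hx.1]; exact hx.2
  have s := SS_summable hc i hx1
  change Summable (fun n => d n * x^n) at s
  have s1 : Summable (fun n => d (n+1) * x^(n+1)) := (summable_nat_add_iff 1 (f := fun n => d n * x^n)).mpr s
  have s2 : Summable (fun n => x * (d n * x^n)) := s.mul_left x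
  have e : ∀ n, f (n+1) * x^(n+1) = d (n+1) * x^(n+1) - x * (d n * x^n) := by
    intro n; simp only [f]; ring
  have sf : Summable (fun n => f n * x^n) := by
    rw [← summable_nat_add_iff 1]
    simp_rw [e]
    exact s1.sub s2
  rw [sf.tsum_eq_zero_add]
  simp_rw [e]
  rw [Summable.tsum_sub s1 s2, tsum_mul_left]
  have : SS c i x = d 0 * x^0 + ∑' n, d (n+1) * x^(n+1) := s.tsum_eq_zero_add
  have h2 : SS c i x = ∑' n, d n * x^n := rfl
  rw [← h2]
  have h3 : f 0 = d 0 := rfl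
  rw [h3]
  linarith

lemma cu_wallis (n : ℕ) : (2*(n:ℝ)+1) * cu n * Real.Wallis.W n = 1 := by
  induction n with
  | zero => simp [cu, poch_zero, Real.Wallis.W]
  | succ n ih =>
    rw [Real.Wallis.W_succ]
    have h := cu_succ n
    have h2 : cu (n+1) = ((n:ℝ)+1/2)^2 * cu n / ((n:ℝ)+1)^2 := by
      rw [← h]; field_simp
    rw [h2]
    refine Eq.trans ?_ ih
    push_cast
    field_simp
    ring

lemma cu_tendsto : Tendsto (fun n : ℕ => (n:ℝ)^1 * cu n) atTop (𝓝 (1/π)) := by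
  have hW := Real.Wallis.tendsto_W_nhds_pi_div_two
  have h1 : Tendsto (fun n : ℕ => (n:ℝ)/(2*n+1)) atTop (𝓝 (1/2)) := by
    have := (tendsto_natCast_div_add_atTop (𝕜 := ℝ) (1/2 : ℝ)).const_mul (1/2)
    rw [mul_one] at this
    refine this.congr (fun n => ?_)
    field_simp
  have h2 := h1.div hW (by positivity)
  have e : (1/2 / (π/2)) = 1/π := by field_simp
  rw [e] at h2
  refine h2.congr (fun n => ?_)
  have := Real.Wallis.W_pos n
  have h3 := cu_wallis n
  simp only [Pi.div_apply]
  field_simp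
  linear_combination (-(n:ℝ)) * h3

lemma cu_tendsto0 : Tendsto (fun n : ℕ => (n:ℝ)^0 * cu n) atTop (𝓝 0) := by
  have h := cu_tendsto.mul (tendsto_inv_atTop_nhds_zero_nat (𝕜 := ℝ))
  rw [mul_zero] at h
  refine h.congr' ?_
  filter_upwards [eventually_gt_atTop 0] with n hn
  have : (n:ℝ) ≠ 0 := by positivity
  field_simp

lemma step {D E r g : ℝ → ℝ} {k : ℕ} (hg : AnalyticAt ℝ g 0) (hr : AnalyticAt ℝ r 0) (hr0 : r 0 ≠ 0)
    (hD : ∀ᶠ p in 𝓝[≠] (0:ℝ), D p = p^k * g p)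
    (hE : ∀ᶠ p in 𝓝[≠] (0:ℝ), p * deriv D p = r p * E p) :
    ∃ h : ℝ → ℝ, AnalyticAt ℝ h 0 ∧ r 0 * h 0 = k * g 0 ∧ ∀ᶠ p in 𝓝[≠] (0:ℝ), E p = p^k * h p := by
  refine ⟨fun p => (k * g p + p * deriv g p) / r p, ?_, ?_, ?_⟩
  · have := hg.deriv
    fun_prop (disch := assumption)
  · field_simp
    simp
  · have h1 := eventually_eventually_nhdsWithin.2 hD
    have h2 : ∀ᶠ p in 𝓝[≠] (0:ℝ), AnalyticAt ℝ g p := hg.eventually_analyticAt.filter_mono nhdsWithin_le_nhds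
    have h3 : ∀ᶠ p in 𝓝[≠] (0:ℝ), r p ≠ 0 :=
      (hr.continuousAt.eventually_ne hr0).filter_mono nhdsWithin_le_nhds
    filter_upwards [h1, h2, h3, hE, self_mem_nhdsWithin] with p h1 h2 h3 h4 hp
    have hp : p ≠ 0 := hp
    have h1' : D =ᶠ[𝓝 p] fun p => p^k * g p := by
      rwa [isOpen_compl_singleton.nhdsWithin_eq hp] at h1
    have hd : HasDerivAt (fun p => p^k * g p) (k * p^(k-1) * g p + p^k * deriv g p) p :=
      (hasDerivAt_pow k p).mul h2.differentiableAt.hasDerivAt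
    rw [h1'.deriv_eq, hd.deriv] at h4
    have h5 : p * (k * p^(k-1)) = k * p^k := by
      rcases k with _ | k
      · simp
      · simp only [Nat.add_sub_cancel]; ring
    field_simp
    linear_combination (-1) * h4 + g p * h5

lemma uniq {D0 D1 D2 r e2 e1 e0 : ℝ → ℝ} (hD : AnalyticAt ℝ D0 0) (h0 : D0 0 = 0)
    (hr : AnalyticAt ℝ r 0) (hr0 : r 0 ≠ 0)
    (he2 : ContinuousAt e2 0) (he1 : ContinuousAt e1 0) (he0 : ContinuousAt e0 0)
    (d0 : ∀ᶠ p in 𝓝[≠] (0:ℝ), p * deriv D0 p = r p * D1 p)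
    (d1 : ∀ᶠ p in 𝓝[≠] (0:ℝ), p * deriv D1 p = r p * D2 p)
    (d2 : ∀ᶠ p in 𝓝[≠] (0:ℝ), p * deriv D2 p = p * (e2 p * D2 p + e1 p * D1 p + e0 p * D0 p)) :
    ∀ᶠ p in 𝓝 (0:ℝ), D0 p = 0 := by
  by_contra hne
  obtain ⟨k, g, hg, hg0, hgk⟩ := hD.exists_eventuallyEq_pow_smul_nonzero_iff.mpr hne
  have hk : k ≠ 0 := by
    rintro rfl
    have := hgk.self_of_nhds
    simp [h0] at this
    exact hg0 this.symm
  have hgk' : ∀ᶠ p in 𝓝[≠] (0:ℝ), D0 p = p^k * g p := by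
    refine (hgk.mono fun p hp => ?_).filter_mono nhdsWithin_le_nhds
    simpa using hp
  obtain ⟨g1, hg1, v1, E1⟩ := step hg hr hr0 hgk' d0
  obtain ⟨g2, hg2, v2, E2⟩ := step hg1 hr hr0 E1 d1
  obtain ⟨g3, hg3, v3, E3⟩ := step (r := fun _ => 1)
    (E := fun p => p * (e2 p * D2 p + e1 p * D1 p + e0 p * D0 p)) hg2 analyticAt_const one_ne_zero E2
    (by simpa using d2)
  have hg30 : g3 0 = 0 := by
    have t1 : Tendsto g3 (𝓝[≠] 0) (𝓝 (g3 0)) := hg3.continuousAt.tendsto.mono_left nhdsWithin_le_nhds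
    have c : ContinuousAt (fun p => p * (e2 p * g2 p + e1 p * g1 p + e0 p * g p)) 0 := by
      have := hg.continuousAt
      have := hg1.continuousAt
      have := hg2.continuousAt
      fun_prop
    have t2 := c.tendsto.mono_left (nhdsWithin_le_nhds (s := {0}ᶜ))
    rw [zero_mul] at t2
    refine tendsto_nhds_unique (t1.congr' ?_) t2
    filter_upwards [hgk', E1, E2, E3, self_mem_nhdsWithin] with p a0 a1 a2 a3 hp
    have hp : p ≠ 0 := hp
    rw [a0, a1, a2] at a3
    have : p^k ≠ 0 := pow_ne_zero _ hp
    apply mul_left_cancel₀ this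
    linear_combination -a3
  have kk : (k:ℝ) ≠ 0 := by exact_mod_cast hk
  rw [hg30, mul_zero] at v3
  have w2 : g2 0 = 0 := by simpa [kk] using v3.symm
  rw [w2, mul_zero] at v2
  have w1 : g1 0 = 0 := by simpa [kk] using v2.symm
  rw [w1, mul_zero] at v1
  exact hg0 (by simpa [kk] using v1.symm)

noncomputable def zz (p : ℝ) : ℝ := 16*p^2*(1-p)/(2-p)^4
noncomputable def qq (p : ℝ) : ℝ := 4-4*p-p^2
noncomputable def rr (p : ℝ) : ℝ := qq p/((1-p)*(2-p))
noncomputable def HH0 (p : ℝ) : ℝ := (1-p/2) * (SS cu 0 p)^2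
noncomputable def NN (p : ℝ) : ℝ := -p/2 * (SS cu 0 p)^2 + (2-p) * (SS cu 0 p * SS cu 1 p)
noncomputable def HH1 (p : ℝ) : ℝ := (1-p)*(2-p)*NN p/qq p
noncomputable def MM (p : ℝ) : ℝ :=
  p^2/4*(SS cu 0 p)^2 + p^2 * (SS cu 0 p * SS cu 1 p) + (2-p)*(1-p)*(SS cu 1 p)^2
noncomputable def HH2 (p : ℝ) : ℝ :=
  (1-p)*(2-p)*(p*(-4+12*p-7*p^2)*NN p + (2-p)*qq p*MM p)/(qq p)^3

lemma qq_pos {p : ℝ} (h : |p| < 3/4) : 0 < qq p := by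
  obtain ⟨h1, h2⟩ := abs_lt.mp h
  unfold qq; nlinarith

lemma zz_lt {p : ℝ} (h : |p| < 3/4) : |zz p| < 1 := by
  have hq := qq_pos h
  obtain ⟨h1, h2⟩ := abs_lt.mp h
  have h3 : 0 < 1 - p := by linarith
  have h4 : 0 < 2 - p := by linarith
  have h5 : 0 ≤ zz p := by unfold zz; positivity
  rw [abs_of_nonneg h5]
  unfold zz
  rw [div_lt_one (by positivity)]
  have : (2-p)^4 - 16*p^2*(1-p) = (qq p)^2 := by unfold qq; ring
  have : 0 < (qq p)^2 := by positivity
  linarith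

lemma zz_deriv {p : ℝ} (h : |p| < 3/4) : HasDerivAt zz (16*p*qq p/(2-p)^5) p := by
  obtain ⟨h1, h2⟩ := abs_lt.mp h
  have h4 : 2 - p ≠ 0 := by linarith
  have hid := hasDerivAt_id' p
  have e := ((((hid.pow 2).const_mul 16).mul (hid.const_sub 1)).div ((hid.const_sub 2).pow 4) (pow_ne_zero _ h4))
  refine (e.congr_deriv ?_)
  simp only [Pi.mul_apply, Pi.pow_apply]
  unfold qq
  field_simp
  ring

lemma G_deriv {p : ℝ} (i : ℕ) (h : |p| < 3/4) :
    ∃ d, HasDerivAt (fun p => SS ca i (zz p)) d p ∧ p * d = rr p * SS ca (i+1) (zz p) := by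
  obtain ⟨h1, h2⟩ := abs_lt.mp h
  have h3 : 1 - p ≠ 0 := by linarith
  have h4 : 2 - p ≠ 0 := by linarith
  have hz := zz_lt h
  refine ⟨_, (SS_analytic ca_le i hz).differentiableAt.hasDerivAt.comp p (zz_deriv h), ?_⟩
  rw [← SS_deriv ca_le i hz]
  have : p * (16*p*qq p/(2-p)^5) = rr p * zz p := by
    unfold rr zz; field_simp
  linear_combination deriv (SS ca i) (zz p) * this

lemma u0_deriv {p : ℝ} (h : |p| < 1) (hp : p ≠ 0) : HasDerivAt (SS cu 0) (SS cu 1 p / p) p := by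
  have := (SS_analytic cu_le 0 h).differentiableAt.hasDerivAt
  refine this.congr_deriv ?_
  rw [eq_div_iff hp, ← SS_deriv cu_le 0 h]; ring

lemma u1_deriv {p : ℝ} (h : |p| < 1) (hp : p ≠ 0) :
    HasDerivAt (SS cu 1) ((SS cu 1 p + SS cu 0 p / 4)/(1-p)) p := by
  have := (SS_analytic cu_le 1 h).differentiableAt.hasDerivAt
  refine this.congr_deriv ?_
  have h3 : 1 - p ≠ 0 := by have := (abs_lt.mp h).2; linarith
  have e := SS_deriv cu_le 1 h
  have o := ode_u h
  rw [← e] at o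
  rw [eq_div_iff h3]
  apply mul_left_cancel₀ hp
  linear_combination o

lemma HH0_deriv {p : ℝ} (h : |p| < 3/4) (hp : p ≠ 0) :
    ∃ d, HasDerivAt HH0 d p ∧ p * d = rr p * HH1 p := by
  obtain ⟨h1, h2⟩ := abs_lt.mp h
  have h3 : 1 - p ≠ 0 := by linarith
  have h4 : 2 - p ≠ 0 := by linarith
  have hq := (qq_pos h).ne'
  have a0 := u0_deriv (p := p) (by linarith) hp
  have hid := hasDerivAt_id' p
  refine ⟨_, ((hid.div_const 2).const_sub 1).mul (a0.pow 2), ?_⟩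
  unfold rr HH1 NN
  field_simp
  ring

lemma NN_deriv {p : ℝ} (h : |p| < 3/4) (hp : p ≠ 0) :
    HasDerivAt NN (MM p / (p * (1-p))) p := by
  obtain ⟨h1, h2⟩ := abs_lt.mp h
  have h3 : 1 - p ≠ 0 := by linarith
  have a0 := u0_deriv (p := p) (by linarith) hp
  have a1 := u1_deriv (p := p) (by linarith) hp
  have hid := hasDerivAt_id' p
  have e := ((hid.neg.div_const 2).mul (a0.pow 2)).add ((hid.const_sub 2).mul (a0.mul a1))
  refine e.congr_deriv ?_
  unfold MM
  simp only [Pi.pow_apply, Pi.mul_apply, Pi.neg_apply]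
  field_simp
  ring

lemma qq_deriv (p : ℝ) : HasDerivAt qq (-4-2*p) p := by
  have hid := hasDerivAt_id' p
  refine (((hid.const_mul 4).const_sub 4).sub (hid.pow 2)).congr_deriv ?_
  simp

lemma HH1_deriv {p : ℝ} (h : |p| < 3/4) (hp : p ≠ 0) :
    ∃ d, HasDerivAt HH1 d p ∧ p * d = rr p * HH2 p := by
  obtain ⟨h1, h2⟩ := abs_lt.mp h
  have h3 : 1 - p ≠ 0 := by linarith
  have h4 : 2 - p ≠ 0 := by linarith
  have hq := (qq_pos h).ne'
  have hid := hasDerivAt_id' p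
  refine ⟨_, (((hid.const_sub 1).mul (hid.const_sub 2)).mul (NN_deriv h hp)).div (qq_deriv p) hq, ?_⟩
  unfold rr HH2
  simp only [Pi.pow_apply, Pi.mul_apply]
  generalize NN p = n
  generalize MM p = m
  field_simp
  unfold qq
  ring

lemma MM_deriv {p : ℝ} (h : |p| < 3/4) (hp : p ≠ 0) :
    HasDerivAt MM (p/2*(SS cu 0 p)^2 + p^2/2*(SS cu 0 p * SS cu 1 p)/p + 2*p*(SS cu 0 p * SS cu 1 p)
      + p*(SS cu 1 p)^2 + p^2*SS cu 0 p * ((SS cu 1 p + SS cu 0 p/4)/(1-p)) + (2*p-3)*(SS cu 1 p)^2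
      + (2-p)*2*SS cu 1 p*(SS cu 1 p + SS cu 0 p/4)) p := by
  obtain ⟨h1, h2⟩ := abs_lt.mp h
  have h3 : 1 - p ≠ 0 := by linarith
  have a0 := u0_deriv (p := p) (by linarith) hp
  have a1 := u1_deriv (p := p) (by linarith) hp
  have hid := hasDerivAt_id' p
  have e := ((((hid.pow 2).div_const 4).mul (a0.pow 2)).add ((hid.pow 2).mul (a0.mul a1))).add
    (((hid.const_sub 2).mul (hid.const_sub 1)).mul (a1.pow 2))
  refine e.congr_deriv ?_
  simp only [Pi.pow_apply, Pi.mul_apply, Pi.neg_apply]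
  field_simp
  ring

lemma HH2_deriv {p : ℝ} (h : |p| < 3/4) (hp : p ≠ 0) :
    ∃ d, HasDerivAt HH2 d p ∧ p * d = p * (16*p/((2-p)*qq p) * (3/2*HH2 p + 11/16*HH1 p + 3/32*HH0 p)) := by
  obtain ⟨h1, h2⟩ := abs_lt.mp h
  have h3 : 1 - p ≠ 0 := by linarith
  have h4 : 2 - p ≠ 0 := by linarith
  have hq := (qq_pos h).ne'
  have hid := hasDerivAt_id' p
  refine ⟨_, (((hid.const_sub 1).mul (hid.const_sub 2)).mul
    (((hid.mul (((hid.const_mul 12).const_add (-4)).sub ((hid.pow 2).const_mul 7))).mul (NN_deriv h hp)).add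
     (((hid.const_sub 2).mul (qq_deriv p)).mul (MM_deriv h hp)))).div ((qq_deriv p).pow 3) (pow_ne_zero _ hq), ?_⟩
  unfold HH2 HH1 HH0
  simp only [Pi.pow_apply, Pi.mul_apply, Pi.add_apply, Pi.sub_apply]
  unfold MM NN
  generalize SS cu 0 p = u at *
  generalize SS cu 1 p = v at *
  field_simp
  unfold qq
  ring

lemma key_eqOn : Set.EqOn (fun p => SS ca 0 (zz p) - HH0 p) 0 (Set.Ioo (-(3/4)) (3/4)) := by
  have han : AnalyticOnNhd ℝ (fun p => SS ca 0 (zz p) - HH0 p) (Set.Ioo (-(3/4)) (3/4)) := by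
    intro p hp
    have h : |p| < 3/4 := abs_lt.mpr hp
    have h4 : (2 - p)^4 ≠ 0 := by have := hp.2; exact pow_ne_zero _ (by linarith)
    have hz : AnalyticAt ℝ zz p := by
      unfold zz
      fun_prop (disch := assumption)
    have h1 : AnalyticAt ℝ (fun p => SS ca 0 (zz p)) p := (SS_analytic ca_le 0 (zz_lt h)).comp hz
    have h2 : AnalyticAt ℝ (SS cu 0) p := SS_analytic cu_le 0 (by linarith)
    have h3 : AnalyticAt ℝ HH0 p := by
      unfold HH0
      fun_prop (disch := norm_num)
    exact h1.sub h3
  have m0 : (0:ℝ) ∈ Set.Ioo (-(3/4) : ℝ) (3/4) := by constructor <;> norm_num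
  refine han.eqOn_zero_of_preconnected_of_eventuallyEq_zero isPreconnected_Ioo m0 ?_
  have ev : ∀ᶠ p in 𝓝[≠] (0:ℝ), |p| < 3/4 ∧ p ≠ 0 := by
    have : ∀ᶠ p in 𝓝[≠] (0:ℝ), p ∈ Set.Ioo (-(3/4) : ℝ) (3/4) :=
      nhdsWithin_le_nhds (Ioo_mem_nhds m0.1 m0.2)
    filter_upwards [this, self_mem_nhdsWithin] with p h hp
    exact ⟨abs_lt.mpr h, hp⟩
  have q0 : qq 0 ≠ 0 := by simp [qq]
  have qc : AnalyticAt ℝ qq 0 := by unfold qq; fun_prop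
  have qcc := qc.continuousAt
  have ec : ∀ c : ℝ, ContinuousAt (fun p => 16*p/((2-p)*qq p) * c) 0 := by
    intro c
    have : (2 - (0:ℝ)) * qq 0 ≠ 0 := mul_ne_zero (by norm_num) q0
    fun_prop (disch := assumption)
  refine uniq (D1 := fun p => SS ca 1 (zz p) - HH1 p) (D2 := fun p => SS ca 2 (zz p) - HH2 p)
    (r := rr) (han 0 m0) ?_ ?_ ?_ (ec (3/2)) (ec (11/16)) (ec (3/32)) ?_ ?_ ?_
  · simp [HH0, zz, SS_zero_zero, ca, cu, poch_zero]
  · have : (1 - (0:ℝ)) * (2 - 0) ≠ 0 := by norm_num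
    unfold rr
    fun_prop (disch := assumption)
  · simp [rr, q0]
  · filter_upwards [ev] with p hp
    obtain ⟨d, hd, e⟩ := G_deriv 0 hp.1
    obtain ⟨d', hd', e'⟩ := HH0_deriv hp.1 hp.2
    rw [(hd.fun_sub hd').deriv]
    linear_combination e - e'
  · filter_upwards [ev] with p hp
    obtain ⟨d, hd, e⟩ := G_deriv 1 hp.1
    obtain ⟨d', hd', e'⟩ := HH1_deriv hp.1 hp.2
    rw [(hd.fun_sub hd').deriv]
    linear_combination e - e'
  · filter_upwards [ev] with p hp
    obtain ⟨d, hd, e⟩ := G_deriv 2 hp.1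
    obtain ⟨d', hd', e'⟩ := HH2_deriv hp.1 hp.2
    rw [(hd.fun_sub hd').deriv]
    have o := ode_a (zz_lt hp.1)
    obtain ⟨h1, h2⟩ := abs_lt.mp hp.1
    have h3 : 1 - p ≠ 0 := by linarith
    have h4 : 2 - p ≠ 0 := by linarith
    have hq := (qq_pos hp.1).ne'
    have z1 : 1 - zz p = (qq p)^2/(2-p)^4 := by
      unfold zz
      rw [eq_div_iff (pow_ne_zero _ h4), sub_mul, div_mul_cancel₀ _ (pow_ne_zero _ h4)]
      unfold qq; ring
    have hz : zz p / (1 - zz p) = 16*p^2*(1-p)/(qq p)^2 := by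
      rw [z1]; unfold zz; field_simp
    have z1' : 1 - zz p ≠ 0 := by rw [z1]; positivity
    have o' : SS ca 3 (zz p) = 16*p^2*(1-p)/(qq p)^2 *
       (3/2 * SS ca 2 (zz p) + 11/16 * SS ca 1 (zz p) + 3/32 * SS ca 0 (zz p)) := by
      rw [← hz]; field_simp; linear_combination 1024 * o
    have hr : rr p * (16*p^2*(1-p)/(qq p)^2) = p * (16*p/((2-p)*qq p)) := by
      unfold rr; field_simp
    rw [o'] at e
    linear_combination e - e' + hr * (3/2 * SS ca 2 (zz p) + 11/16 * SS ca 1 (zz p) + 3/32 * SS ca 0 (zz p))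

lemma wronskian_const : ∀ p ∈ Set.Ioo (0:ℝ) 1,
    (1-p) * SS cu 1 p * SS cu 0 (1-p) + p * SS cu 0 p * SS cu 1 (1-p) = SS cu 0 (1/2) * SS cu 1 (1/2) := by
  intro p hp
  set W : ℝ → ℝ := fun p => (1-p) * SS cu 1 p * SS cu 0 (1-p) + p * SS cu 0 p * SS cu 1 (1-p) with hW
  have hd : ∀ x ∈ Set.Ioo (0:ℝ) 1, HasDerivAt W 0 x := by
    intro x hx
    have h1 : |x| < 1 := by rw [abs_of_pos hx.1]; exact hx.2
    have h2 : |1-x| < 1 := by rw [abs_of_pos (by linarith [hx.2])]; linarith [hx.1]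
    have n1 : x ≠ 0 := hx.1.ne'
    have n2 : 1 - x ≠ 0 := by linarith [hx.2]
    have hid := hasDerivAt_id' x
    have a0 := u0_deriv h1 n1
    have a1 := u1_deriv h1 n1
    have b0 := (u0_deriv h2 n2).comp x (hid.const_sub 1)
    have b1 := (u1_deriv h2 n2).comp x (hid.const_sub 1)
    have e := (((hid.const_sub 1).mul a1).mul b0).add ((hid.mul a0).mul b1)
    refine e.congr_deriv ?_
    simp only [Function.comp, Pi.mul_apply, sub_sub_cancel]
    field_simp
    ring
  have half : (1/2:ℝ) ∈ Set.Ioo (0:ℝ) 1 := by constructor <;> norm_num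
  have := isOpen_Ioo.is_const_of_deriv_eq_zero isPreconnected_Ioo
    (fun x hx => (hd x hx).differentiableAt.differentiableWithinAt) (fun x hx => (hd x hx).deriv) hp half
  refine Eq.trans this ?_
  simp only [hW]
  rw [show (1 - 1/2 : ℝ) = 1/2 by norm_num]
  ring

lemma wronskian : SS cu 0 (1/2) * SS cu 1 (1/2) = 1/π := by
  have t0 := abel_coeff cu_le 0 cu_tendsto0
  have t1 := abel_coeff cu_le 1 cu_tendsto
  have an0 := SS_analytic cu_le 0 (x := 0) (by simp)
  have tp : Tendsto (fun x : ℝ => 1 - x) (𝓝[<] 1) (𝓝 0) := by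
    have : ContinuousAt (fun x : ℝ => 1 - x) 1 := by fun_prop
    simpa using this.tendsto.mono_left nhdsWithin_le_nhds
  have s0 : Tendsto (fun x => SS cu 0 (1-x)) (𝓝[<] 1) (𝓝 1) := by
    have := an0.continuousAt.tendsto.comp tp
    rw [SS_zero_zero] at this
    simpa [cu, poch_zero, Function.comp_def] using this
  have s1 : Tendsto (fun x => deriv (SS cu 0) (1-x)) (𝓝[<] 1) (𝓝 (deriv (SS cu 0) 0)) :=
    an0.deriv.continuousAt.tendsto.comp tp
  have tx : Tendsto (fun x : ℝ => x) (𝓝[<] 1) (𝓝 1) := nhdsWithin_le_nhds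
  have T := ((tx.mul s1).mul t0).add (s0.mul t1)
  rw [mul_zero, one_mul, zero_add] at T
  refine tendsto_nhds_unique (tendsto_const_nhds.congr' ?_) T
  filter_upwards [Ioo_mem_nhdsLT (show (0:ℝ) < 1 by norm_num)] with x hx
  have hm : 1 - x ∈ Set.Ioo (0:ℝ) 1 := ⟨by linarith [hx.2], by linarith [hx.1]⟩
  have w := wronskian_const (1-x) hm
  rw [sub_sub_cancel, ← SS_deriv cu_le 0 (x := 1-x) (by rw [abs_of_pos hm.1]; exact hm.2)] at w
  rw [← w]
  ring

theorem stmt_2 :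
    ∑' n : ℕ, (poch (1/2) n * poch (1/4) n * poch (3/4) n) / (poch 1 n)^3 * (7*(n:ℝ)+1) * ((32:ℝ)/81)^n = 9 / (2*π) := by
  have hz : |(32/81:ℝ)| < 1 := by rw [abs_of_pos] <;> norm_num
  have e : ∀ n : ℕ, (poch (1/2) n * poch (1/4) n * poch (3/4) n) / (poch 1 n)^3 * (7*(n:ℝ)+1) * ((32:ℝ)/81)^n
      = 7 * (((n:ℝ)^1 * ca n) * (32/81)^n) + ((n:ℝ)^0 * ca n) * (32/81)^n := by
    intro n; unfold ca; ring
  simp_rw [e]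
  rw [Summable.tsum_add ((SS_summable ca_le 1 hz).mul_left 7) (SS_summable ca_le 0 hz), tsum_mul_left]
  change 7 * SS ca 1 (32/81) + SS ca 0 (32/81) = _
  have hh : |(1/2:ℝ)| < 3/4 := by rw [abs_of_pos] <;> norm_num
  have hm : (1/2:ℝ) ∈ Set.Ioo (-(3/4) : ℝ) (3/4) := abs_lt.mp hh
  have zv : zz (1/2) = 32/81 := by unfold zz; norm_num
  have k0 := key_eqOn hm
  simp only [Pi.zero_apply] at k0
  obtain ⟨d, hd, e⟩ := G_deriv 0 hh
  obtain ⟨d', hd', e'⟩ := HH0_deriv hh (by norm_num)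
  have k1 : d = d' := by
    have h1 := hd.fun_sub hd'
    have h2 : (fun p => SS ca 0 (zz p) - HH0 p) =ᶠ[𝓝 (1/2:ℝ)] fun _ => 0 :=
      Filter.eventuallyEq_of_mem (Ioo_mem_nhds hm.1 hm.2) key_eqOn
    have h3 := h1.deriv
    rw [h2.deriv_eq, deriv_const] at h3
    linarith
  have r0 : rr (1/2) = 7/3 := by unfold rr qq; norm_num
  rw [← k1, e, r0, zv] at e'
  rw [zv] at k0
  have w := wronskian
  have h1v : HH1 (1/2) = 3/7*(-1/4*(SS cu 0 (1/2))^2 + 3/2 * (SS cu 0 (1/2) * SS cu 1 (1/2))) := by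
    unfold HH1 NN qq; ring
  have h0v : HH0 (1/2) = 3/4*(SS cu 0 (1/2))^2 := by unfold HH0; ring
  rw [h1v] at e'
  rw [h0v] at k0
  have fin : (9:ℝ)/(2*π) = 9/2 * (1/π) := by field_simp
  rw [fin, ← w]
  simp only [zero_add] at e'
  linear_combination 3 * e' + k0
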